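/- Positive maximum principle: Let v:[0,∞)×ℝ^d→ℝ and, for each ξ∈(0,1], let v^{(ξ)}:[0,∞)×ℝ^d→ℝ be bounded on (0,τ]×ℝ^d for every τ>0, C¹ in the time variable and C² in the space variable. Assume that for every τ>0: (i) v^{(ξ)}(t,x)→v(t,x) as ξ→0+, uniformly in t∈[0,τ], x∈ℝ^d; (ii) v^{(ξ)}(t,x)→0 as |x|→∞, uniformly in t∈[0,τ] and ξ∈(0,1]; (iii) for all 0<τ₁<τ₂≤τ, ∂_t v^{(ξ)}(t,x) − 𝓛v^{(ξ)}(t,·)(x) → 0 as ξ→0+, uniformly in t∈[τ₁,τ₂], x∈ℝ^d; (iv) v^{(ξ)}(t,x)→v(0,x) as ξ→0+ and t→0+, uniformly in x∈ℝ^d; (v) v(0,x)≥0 for all x∈ℝ^d. Then v(t,x)≥0 for all t≥0 and x∈ℝ^d. -/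

import Mathlib

open MeasureTheory

/-- The `i`-th column of a matrix, viewed as a vector of `EuclideanSpace ℝ (Fin d)`. -/
noncomputable def matCol (d : ℕ) (M : Matrix (Fin d) (Fin d) ℝ) (i : Fin d) :
    EuclideanSpace ℝ (Fin d) :=
  (EuclideanSpace.equiv (Fin d) ℝ).symm (fun j => M j i)

/-- The operator `𝓛 f(x) = (1/2) Σᵢ ∫_ℝ [f(x+aᵢ(x)w)+f(x−aᵢ(x)w)−2f(x)] μᵢ(w) dw`,
where `aᵢ(x)` is the `i`-th column of `A(x)`. -/
noncomputable def Lop (d : ℕ) (A : EuclideanSpace ℝ (Fin d) → Matrix (Fin d) (Fin d) ℝ)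
    (μ : Fin d → ℝ → ℝ) (f : EuclideanSpace ℝ (Fin d) → ℝ)
    (x : EuclideanSpace ℝ (Fin d)) : ℝ :=
  (1 / 2) * ∑ i, ∫ w : ℝ,
    (f (x + w • matCol d (A x) i) + f (x - w • matCol d (A x) i) - 2 * f x) * μ i w

namespace PMP
section
open Set Filter Topology MeasureTheory

theorem ML {E : Type*} [TopologicalSpace E] (V : ℝ → E → ℝ) (a b β η₀ : ℝ) (K : Set E)
    (hab : a ≤ b) (hβ : 0 ≤ β) (hη : 0 ≤ η₀) (hK : IsCompact K)
    (h1 : ∀ t ∈ Icc a b, ContinuousOn (V t) K)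
    (h2 : ∀ t ∈ Icc a b, ∀ x, x ∉ K → 0 ≤ V t x)
    (h3 : ∀ t ∈ Ioc a b, ∀ x ∈ K, V t x < 0 → (∀ y, V t x ≤ V t y) →
      ∃ h > 0, ∀ s ∈ Ioo (t - h) t, V s x ≤ V t x + β * (t - s))
    (h4 : ∀ r ∈ Ico a b, ∀ η > 0, ∀ h > 0, ∃ r' ∈ Ioo r (r + h), ∀ x ∈ K, V r x - η ≤ V r' x)
    (h5 : ∀ x ∈ K, - η₀ ≤ V a x) :
    ∀ x ∈ K, - η₀ - β * (b - a) ≤ V b x := by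
  intro x₀ hx₀
  by_contra hcon
  push Not at hcon
  set c := V b x₀ + β * (b - a) with hc
  have hc0 : c < - η₀ := by linarith
  let S : Set ℝ := {s | s ∈ Icc a b ∧ ∀ s' ∈ Icc s b, ∃ x ∈ K, V s' x + β * (s' - a) ≤ c}
  have hbS : b ∈ S := ⟨⟨hab, le_rfl⟩, fun s' hs' => by
    have : s' = b := le_antisymm hs'.2 hs'.1
    subst this
    exact ⟨x₀, hx₀, le_rfl⟩⟩
  have hbdd : BddBelow S := ⟨a, fun s hs => hs.1.1⟩
  set s := sInf S with hs
  have has : a ≤ s := le_csInf ⟨b, hbS⟩ (fun s hs => hs.1.1)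
  have hsb : s ≤ b := csInf_le hbdd hbS
  have hgt : ∀ s' ∈ Ioc s b, ∃ x ∈ K, V s' x + β * (s' - a) ≤ c := by
    intro s' hs'
    obtain ⟨z, hz, hzs⟩ := exists_lt_of_csInf_lt ⟨b, hbS⟩ hs'.1
    exact hz.2 s' ⟨hzs.le, hs'.2⟩
  -- minimizer at time s
  obtain ⟨x, hxK, hxmin⟩ := hK.exists_isMinOn ⟨x₀, hx₀⟩ (h1 s ⟨has, hsb⟩)
  have hxc : V s x + β * (s - a) ≤ c := by
    rcases hsb.eq_or_lt with h | h
    · have := hxmin hx₀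
      simp only [mem_ofPred_eq] at this
      rw [h] at this ⊢
      linarith
    · apply le_of_forall_pos_le_add
      intro ε hε
      obtain ⟨r', hr', hV⟩ := h4 s ⟨has, h⟩ ε hε (b - s) (by linarith)
      obtain ⟨y, hy, hyc⟩ := hgt r' ⟨hr'.1, by linarith [hr'.2]⟩
      have h6 := hV y hy
      have h7 : V s x ≤ V s y := hxmin hy
      have : β * (s - a) ≤ β * (r' - a) := mul_le_mul_of_nonneg_left (by linarith [hr'.1]) hβ
      linarith
  rcases has.eq_or_lt with h | h
  · have := h5 x hxK
    rw [← h] at hxc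
    linarith [hxc]
  · have hneg : V s x < 0 := by
      have : 0 ≤ β * (s - a) := mul_nonneg hβ (by linarith)
      linarith
    obtain ⟨δ, hδ, hD⟩ := h3 s ⟨h, hsb⟩ x hxK hneg (fun y => by
      by_cases hy : y ∈ K
      · exact hxmin hy
      · exact hneg.le.trans (h2 s ⟨has, hsb⟩ y hy))
    set z := max a (s - δ / 2) with hz
    have hzs : z < s := max_lt h (by linarith)
    have : z ∈ S := by
      refine ⟨⟨le_max_left _ _, by linarith⟩, fun s' hs' => ?_⟩
      rcases lt_trichotomy s' s with h' | h' | h'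
      · refine ⟨x, hxK, ?_⟩
        have := hD s' ⟨by linarith [hs'.1, le_max_right a (s - δ/2)], h'⟩
        linarith
      · subst h'
        exact ⟨x, hxK, hxc⟩
      · exact hgt s' ⟨h', hs'.2⟩
    exact absurd (csInf_le hbdd this) (not_le.2 hzs)

theorem mazur {X : Type*} [TopologicalSpace X] [CompactSpace X] [T2Space X] [MeasurableSpace X]
    [BorelSpace X] (f : ℕ → C(X, ℝ)) (g : C(X, ℝ)) (M : ℝ) (hM : ∀ k x, |f k x| ≤ M)
    (hlim : ∀ x, Tendsto (fun k => f k x) atTop (𝓝 (g x))) (η : ℝ) (hη : 0 < η) :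
    ∃ F ∈ convexHull ℝ (range f), ∀ x, g x - η < F x := by
  by_contra hcon
  push Not at hcon
  let O : Set C(X, ℝ) := {F | ∀ x, g x - η < F x}
  have hOconv : Convex ℝ O := by
    intro p hp q hq α γ hα hγ hαγ x
    have h1 := hp x
    have h2 := hq x
    simp only [ContinuousMap.add_apply, ContinuousMap.smul_apply, smul_eq_mul]
    have e : g x - η = α * (g x - η) + γ * (g x - η) := by rw [← add_mul, hαγ, one_mul]
    rw [e]
    rcases hα.eq_or_lt with h | h
    · subst h
      have : γ = 1 := by linarith
      subst this
      simpa using h2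
    · have := mul_lt_mul_of_pos_left h1 h
      have := mul_le_mul_of_nonneg_left h2.le hγ
      linarith
  have hOopen : IsOpen O := by
    have : O = {F : C(X, ℝ) | MapsTo (fun x => F x - (g x - η)) univ (Ioi 0)} := by
      ext F
      simp [O, MapsTo]
    rw [this]
    have h := ContinuousMap.isOpen_setOfPred_mapsTo (X := X) (Y := ℝ) (isCompact_univ) (isOpen_Ioi (a := (0:ℝ)))
    let G : C(X, ℝ) := g - ContinuousMap.const X η
    have h' := h.preimage (f := fun F : C(X, ℝ) => F - G) (by fun_prop)
    exact h'
  obtain ⟨ℓ, u, hℓO, hℓC⟩ := geometric_hahn_banach_open hOconv hOopen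
    (convex_convexHull ℝ (range f)) (by
      rw [Set.disjoint_left]
      intro F hF hF'
      obtain ⟨x, hx⟩ := hcon F hF'
      exact absurd (hF x) (not_lt.2 hx))
  have hgO : g ∈ O := fun x => by linarith
  -- ℓ ≤ 0 on nonnegative functions
  have hneg : ∀ p : C(X, ℝ), 0 ≤ p → ℓ p ≤ 0 := by
    intro p hp
    by_contra hpos
    push Not at hpos
    have h1 : ∀ n : ℕ, ℓ g + n * ℓ p < u := by
      intro n
      have : g + (n : ℝ) • p ∈ O := by
        intro x
        have : 0 ≤ (n : ℝ) * p x := mul_nonneg (by positivity) (hp x)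
        simp
        linarith
      have := hℓO _ this
      simpa using this
    obtain ⟨n, hn⟩ := exists_nat_gt ((u - ℓ g) / ℓ p)
    rw [div_lt_iff₀ hpos] at hn
    linarith [h1 n]
  let toC : CompactlySupportedContinuousMap X ℝ →ₗ[ℝ] C(X, ℝ) :=
    { toFun := fun p => p.toContinuousMap
      map_add' := fun _ _ => rfl
      map_smul' := fun _ _ => rfl }
  let Λ : CompactlySupportedContinuousMap X ℝ →ₚ[ℝ] ℝ := PositiveLinearMap.mk₀
    (-(ℓ : C(X, ℝ) →ₗ[ℝ] ℝ) ∘ₗ toC) (by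
      intro p hp
      have := hneg (toC p) hp
      simpa using this)
  let ν := RealRMK.rieszMeasure Λ
  have hrep : ∀ p : C(X, ℝ), ∫ x, p x ∂ν = - ℓ p := by
    intro p
    let p' : CompactlySupportedContinuousMap X ℝ :=
      { toFun := p
        hasCompactSupport' := HasCompactSupport.of_compactSpace _ }
    exact RealRMK.integral_rieszMeasure Λ p'
  have hfin : IsFiniteMeasure ν := by
    constructor
    exact isCompact_univ.measure_lt_top
  have hconv : Tendsto (fun k => ∫ x, f k x ∂ν) atTop (𝓝 (∫ x, g x ∂ν)) := by
    apply tendsto_integral_of_dominated_convergence (fun _ => M)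
    · intro k
      exact (f k).continuous.aestronglyMeasurable
    · exact integrable_const _
    · intro k
      exact Eventually.of_forall (fun x => by simpa using hM k x)
    · exact Eventually.of_forall hlim
  simp only [hrep] at hconv
  have h2 : - ℓ g ≤ - u := by
    apply le_of_tendsto hconv
    exact Eventually.of_forall fun k => neg_le_neg (hℓC _ (subset_convexHull ℝ _ ⟨k, rfl⟩))
  have := hℓO g hgO
  linarith

structure LProp {E : Type*} [NormedAddCommGroup E] [InnerProductSpace ℝ E]
    (L : (E → ℝ) → E → ℝ) : Prop where
  lmin : ∀ f x, ContDiff ℝ 2 f → (∀ y, f x ≤ f y) → 0 ≤ L f x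
  ladd : ∀ f g x, ContDiff ℝ 2 f → ContDiff ℝ 2 g → L (fun y => f y + g y) x = L f x + L g x
  lsmul : ∀ (c : ℝ) f x, ContDiff ℝ 2 f → L (fun y => c * f y) x = c * L f x
  lbdd : ∀ f, ContDiff ℝ 2 f → ∀ R : ℝ, ∃ C : ℝ, ∀ x ∈ Metric.closedBall (0 : E) R, |L f x| ≤ C

structure SSol {E : Type*} [NormedAddCommGroup E] [InnerProductSpace ℝ E]
    (L : (E → ℝ) → E → ℝ) (e M a b : ℝ) (W : ℝ → E → ℝ) : Prop where
  cd : ∀ t ∈ Icc a b, ContDiff ℝ 2 (W t)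
  dt : ∀ t ∈ Icc a b, ∀ x, ∃ D, HasDerivAt (fun s => W s x) D t ∧ L (W t) x - e ≤ D
  bd : ∀ t ∈ Icc a b, ∀ x, |W t x| ≤ M

def RLsc {E : Type*} [NormedAddCommGroup E] (u : ℝ → E → ℝ) (R r : ℝ) : Prop :=
  ∀ R', 0 < R' → R' < R → ∀ η > 0, ∀ᶠ t in 𝓝[>] r,
    ∀ x ∈ Metric.closedBall (0 : E) R', u r x - η ≤ u t x

section
variable {E : Type*} [NormedAddCommGroup E] [InnerProductSpace ℝ E]

theorem SSol.mono {L : (E → ℝ) → E → ℝ} {e M a b a' b' : ℝ} {W : ℝ → E → ℝ}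
    (h : SSol L e M a b W) (ha : a ≤ a') (hb : b' ≤ b) : SSol L e M a' b' W :=
  ⟨fun t ht => h.cd t ⟨ha.trans ht.1, ht.2.trans hb⟩,
   fun t ht => h.dt t ⟨ha.trans ht.1, ht.2.trans hb⟩,
   fun t ht => h.bd t ⟨ha.trans ht.1, ht.2.trans hb⟩⟩

theorem LProp.lsum {L : (E → ℝ) → E → ℝ} (hL : LProp L) {ι : Type*} (s : Finset ι) (θ : ι → ℝ)
    (f : ι → E → ℝ) (hf : ∀ i ∈ s, ContDiff ℝ 2 (f i)) (x : E) :
    L (fun y => ∑ i ∈ s, θ i * f i y) x = ∑ i ∈ s, θ i * L (f i) x := by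
  classical
  induction s using Finset.induction_on with
  | empty =>
    have := hL.lsmul 0 (fun _ => 0) x contDiff_const
    simpa using this
  | insert i s hi ih =>
    have h1 : ContDiff ℝ 2 (f i) := hf i (Finset.mem_insert_self _ _)
    have h2 : ∀ j ∈ s, ContDiff ℝ 2 (f j) := fun j hj => hf j (Finset.mem_insert_of_mem hj)
    simp only [Finset.sum_insert hi]
    rw [hL.ladd (fun y => θ i * f i y) (fun y => ∑ j ∈ s, θ j * f j y) x
      (contDiff_const.mul h1) (ContDiff.sum fun j hj => contDiff_const.mul (h2 j hj)),
      hL.lsmul _ _ _ h1, ih h2]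

theorem leftDini (g : ℝ → ℝ) (D β t : ℝ) (hg : HasDerivAt g D t) (hD : - β < D) :
    ∃ h > 0, ∀ s ∈ Ioo (t - h) t, g s ≤ g t + β * (t - s) := by
  have h1 := (hasDerivAt_iff_tendsto_slope.1 hg).mono_left
    (nhdsWithin_mono t (fun s (hs : s < t) => ne_of_lt hs) : 𝓝[<] t ≤ 𝓝[≠] t)
  have h2 := h1.eventually (lt_mem_nhds hD)
  obtain ⟨l, hl, hl'⟩ := (mem_nhdsLT_iff_exists_Ioo_subset).1 h2
  refine ⟨t - l, by simpa using hl, fun s hs => ?_⟩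
  have hs1 : s ∈ Ioo l t := ⟨by linarith [hs.1], hs.2⟩
  have h3 : - β < slope g t s := hl' hs1
  rw [slope_def_field, lt_div_iff_of_neg (by linarith [hs.2])] at h3
  nlinarith

variable [FiniteDimensional ℝ E]

theorem lemA {L : (E → ℝ) → E → ℝ} (hL : LProp L) (f : E → ℝ) (hf : ContDiff ℝ 2 f)
    (R' R'' M e : ℝ) (hR' : 0 < R') (hR : R' < R'') (hM : ∀ x, |f x| ≤ M) (he : 0 ≤ e) :
    ∃ β ≥ 0, ∀ (W : ℝ → E → ℝ) (a b η₀ : ℝ), a ≤ b → 0 ≤ η₀ → SSol L e M a b W →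
      (∀ x ∈ Metric.closedBall (0 : E) R'', f x - η₀ ≤ W a x) →
      (∀ r ∈ Ico a b, ∀ η > 0, ∃ᶠ r' in 𝓝[>] r,
        ∀ x ∈ Metric.closedBall (0 : E) R'', W r x - η ≤ W r' x) →
      ∀ x ∈ Metric.closedBall (0 : E) R', f x - η₀ - β * (b - a) ≤ W b x := by
  have hM0 : 0 ≤ M := (abs_nonneg _).trans (hM 0)
  let ψ : ContDiffBump (0 : E) := ⟨R', R'', hR', hR⟩
  let φ : E → ℝ := fun x => f x - 2 * M * (1 - ψ x)
  have hφ : ContDiff ℝ 2 φ := hf.sub (contDiff_const.mul (contDiff_const.sub ψ.contDiff))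
  obtain ⟨C, hC⟩ := hL.lbdd φ hφ R''
  have hC0 : 0 ≤ C := (abs_nonneg _).trans (hC 0 (Metric.mem_closedBall_self (by linarith)))
  refine ⟨C + e + 1, by positivity, ?_⟩
  intro W a b η₀ hab hη hW hstart hwrl x hx
  have key := ML (fun t x => W t x - φ x) a b (C + e + 1) η₀ (Metric.closedBall (0 : E) R'')
    hab (by positivity) hη (isCompact_closedBall _ _)
    (fun t ht => ((hW.cd t ht).continuous.sub hφ.continuous).continuousOn)
    (by
      intro t ht y hy
      have h0 : ψ y = 0 := ψ.zero_of_le_dist (by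
        have : R'' < dist y 0 := by simpa using hy
        exact this.le)
      have h1 := abs_le.1 (hW.bd t ht y)
      have h2 := abs_le.1 (hM y)
      simp only [φ, h0]
      linarith [h1.1, h2.2])
    (by
      intro t ht y hy _ hmin
      have ht' : t ∈ Icc a b := ⟨ht.1.le, ht.2⟩
      obtain ⟨D, hD, hLD⟩ := hW.dt t ht' y
      have h1 := hL.lmin (fun z => W t z - φ z) y ((hW.cd t ht').sub hφ) hmin
      have h2 := hL.ladd (fun z => W t z - φ z) φ y ((hW.cd t ht').sub hφ) hφ
      simp only [sub_add_cancel] at h2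
      have h3 := abs_le.1 (hC y hy)
      have h4 : L (W t) y = L (fun z => W t z - φ z) y + L φ y := h2
      obtain ⟨h, hh, hs⟩ := leftDini _ D (C + e + 1) t hD (by linarith [h3.1])
      refine ⟨h, hh, fun s hs' => ?_⟩
      have := hs s hs'
      linarith)
    (by
      intro r hr η hη h hh
      obtain ⟨r', h1, h2⟩ := ((hwrl r hr η hη).and_eventually
        (Ioo_mem_nhdsGT (show r < r + h by linarith))).exists
      exact ⟨r', h2, fun y hy => by have := h1 y hy; linarith⟩)
    (by
      intro y hy
      have h1 := hstart y hy
      have h2 : ψ y ≤ 1 := ψ.le_one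
      have : 0 ≤ 2 * M * (1 - ψ y) := by
        apply mul_nonneg (by positivity); linarith
      simp only [φ]
      linarith)
    x (Metric.closedBall_subset_closedBall hR.le hx)
  have h1 : ψ x = 1 := ψ.one_of_mem_closedBall hx
  simp only [φ, h1] at key
  linarith

theorem SSol.sum {L : (E → ℝ) → E → ℝ} (hL : LProp L) {e M a b a' b' : ℝ} {u : ℝ → E → ℝ}
    (h : SSol L e M a b u) {ι : Type*} [Fintype ι] (θ ε : ι → ℝ) (hθ : ∀ i, 0 ≤ θ i)
    (hθ1 : ∑ i, θ i = 1) (hε : ∀ i, ∀ t ∈ Icc a' b', t + ε i ∈ Icc a b) :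
    SSol L e M a' b' (fun t x => ∑ i, θ i * u (t + ε i) x) := by
  refine ⟨fun t ht => ?_, fun t ht x => ?_, fun t ht x => ?_⟩
  · exact ContDiff.sum fun i _ => contDiff_const.mul (h.cd _ (hε i t ht))
  · choose D hD hLD using fun i => h.dt _ (hε i t ht) x
    refine ⟨∑ i, θ i * D i, ?_, ?_⟩
    · apply HasDerivAt.fun_sum
      intro i _
      exact ((hD i).comp_add_const t (ε i)).const_mul (θ i)
    · rw [hL.lsum Finset.univ θ (fun i => u (t + ε i)) (fun i _ => h.cd _ (hε i t ht)) x]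
      have : e = ∑ i, θ i * e := by rw [← Finset.sum_mul, hθ1, one_mul]
      rw [this, ← Finset.sum_sub_distrib]
      apply Finset.sum_le_sum
      intro i _
      rw [← mul_sub]
      exact mul_le_mul_of_nonneg_left (hLD i) (hθ i)
  · calc |∑ i, θ i * u (t + ε i) x| ≤ ∑ i, |θ i * u (t + ε i) x| := Finset.abs_sum_le_sum_abs _ _
      _ ≤ ∑ i, θ i * M := by
        apply Finset.sum_le_sum
        intro i _
        rw [abs_mul, abs_of_nonneg (hθ i)]
        exact mul_le_mul_of_nonneg_left (h.bd _ (hε i t ht) x) (hθ i)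
      _ = M := by rw [← Finset.sum_mul, hθ1, one_mul]

theorem SSol.cont {L : (E → ℝ) → E → ℝ} {e M a b : ℝ} {u : ℝ → E → ℝ}
    (h : SSol L e M a b u) {t : ℝ} (ht : t ∈ Icc a b) (x : E) :
    ContinuousAt (fun s => u s x) t := by
  obtain ⟨D, hD, _⟩ := h.dt t ht x
  exact hD.continuousAt

theorem rlsc_of_bound (u : ℝ → E → ℝ) (R r : ℝ)
    (H : ∀ R', 0 < R' → R' < R → ∃ β ≥ 0, ∃ b > r, ∀ t ∈ Ioo r b,
      ∀ x ∈ Metric.closedBall (0 : E) R', u r x - β * (t - r) ≤ u t x) : RLsc u R r := by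
  intro R' hR' hR η hη
  obtain ⟨β, hβ, b, hb, h⟩ := H R' hR' hR
  have hq : 0 < η / (β + 1) := by positivity
  filter_upwards [Ioo_mem_nhdsGT hb, Ioo_mem_nhdsGT (show r < r + η / (β + 1) by linarith)]
    with t ht ht2 x hx
  have h1 := h t ht x hx
  have h2 : t - r < η / (β + 1) := by linarith [ht2.2]
  rw [lt_div_iff₀ (by positivity)] at h2
  nlinarith [ht.1]

variable [MeasurableSpace E] [BorelSpace E]

theorem case1 {L : (E → ℝ) → E → ℝ} (hL : LProp L) {e M a T : ℝ} (he : 0 ≤ e) {u : ℝ → E → ℝ}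
    (hu : SSol L e M a T u) (R r h : ℝ) (hr : r ∈ Ico a T) (hh : 0 < h)
    (hg : ∀ s ∈ Ioo r (r + h), s < T → RLsc u R s) : RLsc u R r := by
  apply rlsc_of_bound
  intro R' hR' hR
  have hrI : r ∈ Icc a T := ⟨hr.1, hr.2.le⟩
  obtain ⟨β, hβ, hA⟩ := lemA hL (u r) (hu.cd r hrI) R' ((R' + R) / 2) M e hR' (by linarith)
    (hu.bd r hrI) he
  set R'' := (R' + R) / 2 with hR''
  refine ⟨β, hβ, min (r + h) T, lt_min (by linarith) hr.2, ?_⟩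
  set b := min (r + h) T with hb
  intro t ht x hx
  have hbT : b ≤ T := min_le_right _ _
  have hbh : b ≤ r + h := min_le_left _ _
  apply le_of_forall_pos_le_add
  intro ε hε
  have htI : t ∈ Icc a T := ⟨by linarith [hr.1, ht.1], by linarith [ht.2]⟩
  obtain ⟨ρ, hρ, hρc⟩ := Metric.continuousAt_iff.1 (hu.cont htI x) (ε / 2) (by positivity)
  set κ := min ρ (b - t) with hκ
  have hκ0 : 0 < κ := lt_min hρ (by linarith [ht.2])
  let q : ℕ → ℝ := fun k => κ * (1 / ((k : ℝ) + 2))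
  have hq0 : ∀ k, 0 < q k := fun k => by positivity
  have hqκ : ∀ k, q k < κ := fun k => by
    have : 1 / ((k : ℝ) + 2) < 1 := by
      rw [div_lt_one (by positivity)]
      have : (0 : ℝ) ≤ k := by positivity
      linarith
    calc q k < κ * 1 := mul_lt_mul_of_pos_left this hκ0
      _ = κ := mul_one _
  have hqlim : Tendsto q atTop (𝓝 0) := by
    have h1 : Tendsto (fun k : ℕ => ((k : ℝ) + 2)) atTop atTop :=
      tendsto_atTop_add_const_right _ _ tendsto_natCast_atTop_atTop
    have h2 := (h1.inv_tendsto_atTop).const_mul κ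
    simpa [q] using h2
  have hκb : κ ≤ b - t := min_le_right _ _
  have hqI : ∀ k, ∀ s ∈ Icc r t, s + q k ∈ Icc a T := fun k s hs =>
    ⟨by linarith [hr.1, hs.1, hq0 k], by linarith [hs.2, hqκ k]⟩
  have hrr : r ∈ Icc r t := ⟨le_rfl, ht.1.le⟩
  haveI : CompactSpace (Metric.closedBall (0 : E) R'') :=
    isCompact_iff_compactSpace.1 (isCompact_closedBall _ _)
  obtain ⟨F, hF, hFg⟩ := mazur (X := Metric.closedBall (0 : E) R'')
    (fun k => ⟨fun y => u (r + q k) y, (hu.cd _ (hqI k r hrr)).continuous.comp continuous_subtype_val⟩)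
    ⟨fun y => u r y, (hu.cd _ hrI).continuous.comp continuous_subtype_val⟩ M
    (fun k y => hu.bd _ (hqI k r hrr) y)
    (fun y => by
      have h1 : Tendsto (fun k => r + q k) atTop (𝓝 r) := by
        simpa using hqlim.const_add r
      exact (hu.cont hrI (y : E)).tendsto.comp h1) (ε / 2) (by positivity)
  obtain ⟨ι, _, θ, z, hθ, hθ1, hz, hsum⟩ := mem_convexHull_iff_exists_fintype.1 hF
  choose k hk using hz
  have hstart : ∀ y ∈ Metric.closedBall (0 : E) R'',
      u r y - ε / 2 ≤ ∑ i, θ i * u (r + q (k i)) y := by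
    intro y hy
    have h1 := hFg ⟨y, hy⟩
    rw [← hsum] at h1
    simp only [← hk] at h1
    simp only [ContinuousMap.coe_sum, Finset.sum_apply, ContinuousMap.coe_smul, Pi.smul_apply,
      ContinuousMap.coe_mk, smul_eq_mul] at h1
    exact h1.le
  have hfin := hA (fun s y => ∑ i, θ i * u (s + q (k i)) y) r t (ε / 2) ht.1.le (by positivity)
    (hu.sum hL θ (fun i => q (k i)) hθ hθ1 (fun i s hs => hqI _ s hs)) hstart
    (by
      intro s hs η hη
      apply Eventually.frequently
      have : ∀ i, ∀ᶠ s' in 𝓝[>] s, ∀ y ∈ Metric.closedBall (0 : E) R'',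
          u (s + q (k i)) y - η ≤ u (s' + q (k i)) y := by
        intro i
        have h1 := hg (s + q (k i)) ⟨by linarith [hs.1, hq0 (k i)], by linarith [hs.2, hqκ (k i)]⟩
          (by linarith [hs.2, hqκ (k i)]) R'' (by linarith) (by linarith) η hη
        have h2 : Tendsto (fun s' => s' + q (k i)) (𝓝[>] s) (𝓝[>] (s + q (k i))) := by
          apply tendsto_nhdsWithin_of_tendsto_nhds_of_eventually_within
          · exact ((continuous_id.add continuous_const).tendsto s).mono_left nhdsWithin_le_nhds
          · filter_upwards [self_mem_nhdsWithin] with s' hs'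
            have : s < s' := hs'
            simp [this]
        exact h2.eventually h1
      filter_upwards [eventually_all.2 this] with s' hs' y hy
      have e1 : η = ∑ i, θ i * η := by rw [← Finset.sum_mul, hθ1, one_mul]
      rw [e1, ← Finset.sum_sub_distrib]
      apply Finset.sum_le_sum
      intro i _
      rw [← mul_sub]
      exact mul_le_mul_of_nonneg_left (hs' i y hy) (hθ i))
    x hx
  have hup : ∑ i, θ i * u (t + q (k i)) x ≤ u t x + ε / 2 := by
    have e1 : u t x + ε / 2 = ∑ i, θ i * (u t x + ε / 2) := by
      rw [← Finset.sum_mul, hθ1, one_mul]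
    rw [e1]
    apply Finset.sum_le_sum
    intro i _
    apply mul_le_mul_of_nonneg_left _ (hθ i)
    have h1 : dist (t + q (k i)) t < ρ := by
      simp only [Real.dist_eq, add_sub_cancel_left, abs_of_pos (hq0 _)]
      exact (hqκ _).trans_le (min_le_left _ _)
    have h2 := hρc h1
    rw [Real.dist_eq] at h2
    linarith [(abs_lt.1 h2).2]
  linarith

theorem allRL {L : (E → ℝ) → E → ℝ} (hL : LProp L) {e M a T : ℝ} (he : 0 ≤ e) {u : ℝ → E → ℝ}
    (hu : SSol L e M a T u) (R : ℝ) : ∀ r ∈ Ico a T, RLsc u R r := by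
  by_contra hcon
  push Not at hcon
  obtain ⟨r₀, hr₀, hr₀'⟩ := hcon
  let B : Set ℝ := {r | r ∈ Ico a T ∧ ¬ RLsc u R r}
  let F : Set ℝ := closure B
  have hFI : F ⊆ Icc a T := closure_minimal (fun r hr => ⟨hr.1.1, hr.1.2.le⟩) isClosed_Icc
  have hFc : IsClosed F := isClosed_closure
  haveI : CompleteSpace F := hFc.completeSpace_coe
  haveI : Nonempty F := ⟨⟨r₀, subset_closure ⟨hr₀, hr₀'⟩⟩⟩
  let Bl := Metric.closedBall (0 : E) R
  let K : ℕ → Set F := fun n => {t | ∀ x ∈ Bl, ∀ y ∈ Bl, |u t x - u t y| ≤ n * ‖x - y‖}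
  have hcontF : ∀ x, Continuous (fun t : F => u t x) := fun x =>
    continuous_iff_continuousAt.2 fun t =>
      ContinuousAt.comp (f := Subtype.val) (g := fun s => u s x) (hu.cont (hFI t.2) x)
        continuous_subtype_val.continuousAt
  have hKc : ∀ n, IsClosed (K n) := by
    intro n
    simp only [K, Set.ofPred_forall]
    refine isClosed_iInter fun x => isClosed_iInter fun _ => isClosed_iInter fun y =>
      isClosed_iInter fun _ => ?_
    exact isClosed_le (((hcontF x).sub (hcontF y)).abs) continuous_const
  have hKu : ⋃ n, K n = univ := by
    rw [eq_univ_iff_forall]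
    intro t
    obtain ⟨C, hC⟩ := ((hu.cd _ (hFI t.2)).contDiffOn (s := Bl)).exists_lipschitzOnWith
      (by norm_num) (convex_closedBall _ _) (isCompact_closedBall _ _)
    obtain ⟨n, hn⟩ := exists_nat_ge (C : ℝ)
    refine mem_iUnion.2 ⟨n, fun x hx y hy => ?_⟩
    have h1 := hC.dist_le_mul x hx y hy
    rw [Real.dist_eq, dist_eq_norm] at h1
    exact h1.trans (mul_le_mul_of_nonneg_right hn (norm_nonneg _))
  obtain ⟨n, p, hp⟩ := nonempty_interior_of_iUnion_of_closed hKc hKu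
  obtain ⟨ρ, hρ, hball⟩ := Metric.isOpen_iff.1 isOpen_interior p hp
  have hKn : ∀ t ∈ F, |t - p| < ρ → ∀ x ∈ Bl, ∀ y ∈ Bl, |u t x - u t y| ≤ n * ‖x - y‖ := by
    intro t ht htp
    have : (⟨t, ht⟩ : F) ∈ Metric.ball p ρ := by
      simpa [Subtype.dist_eq, Real.dist_eq] using htp
    exact interior_subset (hball this)
  obtain ⟨b, hbB, hbp⟩ := Metric.mem_closure_iff.1 p.2 ρ hρ
  rw [Real.dist_eq, abs_lt] at hbp
  have hc1 : ∀ s ∈ Ico a T, (∃ h > 0, ∀ s' ∈ Ioo s (s + h), s' ∉ F) → RLsc u R s := by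
    rintro s hs ⟨h, hh, hF⟩
    refine case1 hL he hu R s h hs hh (fun s' hs' hT => ?_)
    by_contra hbad
    exact hF s' hs' (subset_closure ⟨⟨by linarith [hs.1, hs'.1], hT⟩, hbad⟩)
  apply hbB.2
  have hbI : b ∈ Icc a T := ⟨hbB.1.1, hbB.1.2.le⟩
  apply rlsc_of_bound
  intro R' hR' hR
  obtain ⟨β, hβ, hA⟩ := lemA hL (u b) (hu.cd b hbI) R' ((R' + R) / 2) M e hR' (by linarith)
    (hu.bd b hbI) he
  set R'' := (R' + R) / 2 with hR''
  refine ⟨β, hβ, min T (p + ρ), lt_min hbB.1.2 (by linarith [hbp.1]), ?_⟩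
  intro t ht x hx
  have htT : t < T := ht.2.trans_le (min_le_left _ _)
  have htp : t < p + ρ := ht.2.trans_le (min_le_right _ _)
  have hfin := hA u b t 0 ht.1.le le_rfl (hu.mono hbI.1 htT.le) (fun y _ => by linarith)
    (by
      intro s hs η hη
      have hsI : s ∈ Ico a T := ⟨by linarith [hs.1, hbI.1], by linarith [hs.2]⟩
      by_cases hgap : ∃ h > 0, ∀ s' ∈ Ioo s (s + h), s' ∉ F
      · exact (hc1 s hsI hgap R'' (by linarith) (by linarith) η hη).frequently
      · push Not at hgap
        have hsF : s ∈ F := by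
          rw [← hFc.closure_eq, Metric.mem_closure_iff]
          intro ε hε
          obtain ⟨s', hs', hF'⟩ := hgap ε hε
          refine ⟨s', hF', ?_⟩
          rw [Real.dist_eq, abs_lt]
          constructor <;> linarith [hs'.1, hs'.2]
        have hfreq : ∃ᶠ s' in 𝓝[>] s, s' ∈ F := by
          rw [frequently_iff]
          intro U hU
          obtain ⟨w, hw, hwU⟩ := (mem_nhdsGT_iff_exists_Ioo_subset).1 hU
          obtain ⟨s', hs', hF'⟩ := hgap (w - s) (by simpa using hw)
          exact ⟨s', hwU ⟨hs'.1, by linarith [hs'.2]⟩, hF'⟩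
        have hLs := hKn s hsF (by rw [abs_lt]; constructor <;> linarith [hs.1, hs.2, hbp.2])
        set ρ₁ := η / (4 * ((n : ℝ) + 1)) with hρ₁
        have hρ₁0 : 0 < ρ₁ := by positivity
        have hnρ : (n : ℝ) * ρ₁ ≤ η / 4 := by
          rw [hρ₁, mul_div_assoc', div_le_div_iff₀ (by positivity) (by positivity)]
          nlinarith
        obtain ⟨N, hNK, hNf, hNc⟩ :=
          (isCompact_closedBall (0 : E) R).finite_cover_balls hρ₁0
        have hev : ∀ᶠ s' in 𝓝[>] s, ∀ y ∈ N, dist (u s' y) (u s y) < η / 2 := by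
          rw [eventually_all_finite hNf]
          intro y _
          exact ((Metric.tendsto_nhds.1 (hu.cont ⟨hsI.1, hsI.2.le⟩ y).tendsto) (η / 2)
            (by positivity)).filter_mono nhdsWithin_le_nhds
        have hIoo := Ioo_mem_nhdsGT (show s < p + ρ by linarith [hs.2])
        refine (hfreq.and_eventually (hev.and hIoo)).mono ?_
        rintro s' ⟨hF', hN, hs'⟩ y hy
        have hyB : y ∈ Bl := Metric.closedBall_subset_closedBall (by linarith) hy
        have hLs' := hKn s' hF' (by
          rw [abs_lt]; constructor <;> linarith [hs.1, hs'.1, hs'.2, hbp.2])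
        obtain ⟨y', hy'N, hyy⟩ := mem_iUnion₂.1 (hNc hyB)
        have hd : ‖y - y'‖ < ρ₁ := by simpa [dist_eq_norm] using hyy
        have hd' : (n : ℝ) * ‖y - y'‖ ≤ η / 4 :=
          (mul_le_mul_of_nonneg_left hd.le (by positivity)).trans hnρ
        have h1 := abs_le.1 (hLs y hyB y' (hNK hy'N))
        have h2 := abs_le.1 (hLs' y hyB y' (hNK hy'N))
        have h3 := hN y' hy'N
        rw [Real.dist_eq, abs_lt] at h3
        linarith [h1.1, h1.2, h2.1, h2.2, h3.1, h3.2])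
    x hx
  linarith

theorem mainProp {L : (E → ℝ) → E → ℝ} (hL : LProp L) {e M a T : ℝ} (he : 0 < e)
    {u : ℝ → E → ℝ} (haT : a ≤ T) (hu : SSol L e M a T u) (R ε : ℝ) (hR : 0 < R) (hε : 0 ≤ ε)
    (hdec : ∀ t ∈ Icc a T, ∀ x, R ≤ ‖x‖ → |u t x| ≤ ε) (hst : ∀ x, - ε ≤ u a x) :
    ∀ x, - ε - (2 * e) * (T - a) ≤ u T x := by
  have hrl := allRL hL he.le hu (R + 1)
  have key := ML (fun t x => u t x + ε) a T (2 * e) 0 (Metric.closedBall (0 : E) R) haT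
    (by positivity) le_rfl (isCompact_closedBall _ _)
    (fun t ht => ((hu.cd t ht).continuous.add continuous_const).continuousOn)
    (by
      intro t ht x hx
      have : R < ‖x‖ := by simpa using hx
      linarith [(abs_le.1 (hdec t ht x this.le)).1])
    (by
      intro t ht x _ _ hmin
      have ht' : t ∈ Icc a T := ⟨ht.1.le, ht.2⟩
      obtain ⟨D, hD, hLD⟩ := hu.dt t ht' x
      have h1 := hL.lmin (u t) x (hu.cd t ht') (fun y => by have := hmin y; linarith)
      obtain ⟨h, hh, hs⟩ := leftDini _ D (2 * e) t hD (by linarith)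
      refine ⟨h, hh, fun s hs' => ?_⟩
      have := hs s hs'
      linarith)
    (by
      intro r hr η hη h hh
      obtain ⟨r', h1, h2⟩ := ((hrl r hr R hR (by linarith) η hη).and
        (Ioo_mem_nhdsGT (show r < r + h by linarith))).exists
      exact ⟨r', h2, fun y hy => by have := h1 y hy; linarith⟩)
    (fun x _ => by have := hst x; linarith)
  intro x
  by_cases hx : x ∈ Metric.closedBall (0 : E) R
  · have := key x hx
    linarith
  · have : R < ‖x‖ := by simpa using hx
    have h1 := (abs_le.1 (hdec T ⟨haT, le_rfl⟩ x this.le)).1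
    have : 0 ≤ (2 * e) * (T - a) := mul_nonneg (by positivity) (by linarith)
    linarith

end
theorem second_diff {E : Type*} [NormedAddCommGroup E] [InnerProductSpace ℝ E]
    [FiniteDimensional ℝ E] (f : E → ℝ) (hf : ContDiff ℝ 2 f) (R S : ℝ) :
    ∃ C ≥ 0, ∀ x ∈ Metric.closedBall (0 : E) R, ∀ z : E, ‖z‖ ≤ S →
      |f (x + z) + f (x - z) - 2 * f x| ≤ C * ‖z‖ ^ 2 := by
  have hf' : ContDiff ℝ 1 (fderiv ℝ f) := hf.fderiv_right (by norm_num)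
  obtain ⟨K, hK⟩ := (hf'.contDiffOn (s := Metric.closedBall (0 : E) (R + S))).exists_lipschitzOnWith
    (by norm_num) (convex_closedBall _ _) (isCompact_closedBall _ _)
  refine ⟨2 * K, by positivity, ?_⟩
  intro x hx z hz
  have hx' : ‖x‖ ≤ R := by simpa using hx
  have hdf : Differentiable ℝ f := hf.differentiable (by norm_num)
  have key : ∀ y ∈ Metric.closedBall x ‖z‖, ‖f y - f x - fderiv ℝ f x (y - x)‖ ≤ (K * ‖z‖) * ‖y - x‖ := by
    intro y hy
    refine (convex_closedBall x ‖z‖).norm_image_sub_le_of_norm_fderiv_le' (𝕜 := ℝ)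
      (fun p _ => hdf p) ?_ (Metric.mem_closedBall_self (norm_nonneg _)) hy
    intro p hp
    have hp' : ‖p - x‖ ≤ ‖z‖ := by simpa [dist_eq_norm] using hp
    have h1 : ‖p‖ ≤ R + S := by
      have := norm_add_le x (p - x)
      rw [add_sub_cancel] at this
      linarith
    have h2 := hK.norm_sub_le (x := p) (y := x) (by simpa using h1)
      (by have := norm_nonneg z; simp; linarith)
    exact h2.trans (by gcongr)
  have h1 := key (x + z) (by simp)
  have h2 := key (x - z) (by simp)
  simp only [add_sub_cancel_left, sub_sub_cancel_left, norm_neg, map_neg, Real.norm_eq_abs] at h1 h2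
  rw [abs_le] at *
  constructor <;> nlinarith [h1.1, h1.2, h2.1, h2.2]

theorem matCol_norm (d : ℕ) (M : Matrix (Fin d) (Fin d) ℝ) (i : Fin d) (η : ℝ)
    (hM : ∀ i j, |M i j| ≤ η) : ‖matCol d M i‖ ≤ √(d * η ^ 2) := by
  rw [EuclideanSpace.norm_eq]
  apply Real.sqrt_le_sqrt
  calc _ ≤ ∑ j : Fin d, η ^ 2 := by
        apply Finset.sum_le_sum
        intro j _
        have : ‖(matCol d M i) j‖ ≤ η := hM j i
        gcongr
    _ = _ := by simp

theorem Lop_LProp (d : ℕ) (δ η₁ : ℝ)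
    (A : EuclideanSpace ℝ (Fin d) → Matrix (Fin d) (Fin d) ℝ)
    (hAbd : ∀ x i j, |A x i j| ≤ η₁)
    (μ : Fin d → ℝ → ℝ)
    (hμmeas : ∀ i, Measurable (μ i))
    (hμnonneg : ∀ i, ∀ w : ℝ, 0 ≤ μ i w)
    (hμsupp : ∀ i, ∀ w : ℝ, 2 * δ < |w| → μ i w = 0)
    (hμmom : ∀ i, Integrable (fun w : ℝ => w ^ 2 * μ i w)) : LProp (Lop d A μ) := by
  set N := √(d * η₁ ^ 2) with hN
  have hN0 : 0 ≤ N := Real.sqrt_nonneg _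
  have bnd : ∀ f : EuclideanSpace ℝ (Fin d) → ℝ, ContDiff ℝ 2 f → ∀ R : ℝ, ∃ C ≥ 0,
      ∀ x ∈ Metric.closedBall (0 : EuclideanSpace ℝ (Fin d)) R, ∀ i, ∀ w : ℝ,
        ‖(f (x + w • matCol d (A x) i) + f (x - w • matCol d (A x) i) - 2 * f x) * μ i w‖
          ≤ C * (w ^ 2 * μ i w) := by
    intro f hf R
    obtain ⟨C, hC0, hC⟩ := second_diff f hf R (2 * δ * N)
    refine ⟨C * N ^ 2, by positivity, ?_⟩
    intro x hx i w
    have hn : ‖matCol d (A x) i‖ ≤ N := matCol_norm d (A x) i η₁ (hAbd x)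
    rw [norm_mul, Real.norm_eq_abs, Real.norm_eq_abs, abs_of_nonneg (hμnonneg i w), ← mul_assoc]
    rcases lt_or_ge (2 * δ) |w| with h | h
    · simp [hμsupp i w h]
    · apply mul_le_mul_of_nonneg_right _ (hμnonneg i w)
      have hz : ‖w • matCol d (A x) i‖ ≤ |w| * N := by
        rw [norm_smul, Real.norm_eq_abs]; gcongr
      refine (hC x hx _ (hz.trans (by gcongr))).trans ?_
      calc C * ‖w • matCol d (A x) i‖ ^ 2 ≤ C * (|w| * N) ^ 2 := by gcongr
        _ = _ := by rw [mul_pow, sq_abs]; ring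
  have int : ∀ f : EuclideanSpace ℝ (Fin d) → ℝ, ContDiff ℝ 2 f → ∀ x i, Integrable (fun w : ℝ =>
      (f (x + w • matCol d (A x) i) + f (x - w • matCol d (A x) i) - 2 * f x) * μ i w) := by
    intro f hf x i
    obtain ⟨C, hC0, hC⟩ := bnd f hf ‖x‖
    refine Integrable.mono' ((hμmom i).const_mul C) ?_ (ae_of_all _ (hC x (by simp) i))
    apply AEStronglyMeasurable.mul _ (hμmeas i).aestronglyMeasurable
    apply Continuous.aestronglyMeasurable
    have := hf.continuous
    fun_prop
  refine ⟨?_, ?_, ?_, ?_⟩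
  · intro f x hf hmin
    unfold Lop
    refine mul_nonneg (by norm_num) (Finset.sum_nonneg fun i _ => integral_nonneg fun w => ?_)
    refine mul_nonneg ?_ (hμnonneg i w)
    linarith [hmin (x + w • matCol d (A x) i), hmin (x - w • matCol d (A x) i)]
  · intro f g x hf hg
    unfold Lop
    rw [← mul_add, ← Finset.sum_add_distrib]
    congr 1
    refine Finset.sum_congr rfl fun i _ => ?_
    rw [← integral_add (int f hf x i) (int g hg x i)]
    congr 1
    ext w
    ring
  · intro c f x hf
    unfold Lop
    rw [mul_left_comm c, Finset.mul_sum _ _ c]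
    congr 1
    refine Finset.sum_congr rfl fun i _ => ?_
    rw [← integral_const_mul]
    congr 1
    ext w
    ring
  · intro f hf R
    obtain ⟨C, hC0, hC⟩ := bnd f hf R
    refine ⟨(1 / 2) * ∑ i, ∫ w : ℝ, C * (w ^ 2 * μ i w), ?_⟩
    intro x hx
    unfold Lop
    rw [abs_mul, abs_of_pos (by norm_num : (0 : ℝ) < 1 / 2)]
    refine mul_le_mul_of_nonneg_left ?_ (by norm_num)
    refine (Finset.abs_sum_le_sum_abs _ _).trans (Finset.sum_le_sum fun i _ => ?_)
    exact norm_integral_le_of_norm_le ((hμmom i).const_mul C) (ae_of_all _ (hC x hx i))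

end

end PMP

/-- positive maximum principle for approximate solutions of the heat
equation `∂ₜv = 𝓛v`. -/
theorem stmt_19 (d : ℕ) (hd : 2 ≤ d) (δ η₁ η₂ η₃ : ℝ) (hδ : 0 < δ)
    (hη₁ : 1 ≤ η₁) (hη₂ : 0 < η₂) (hη₃ : 1 ≤ η₃)
    (A : EuclideanSpace ℝ (Fin d) → Matrix (Fin d) (Fin d) ℝ)
    (hAbd : ∀ x i j, |A x i j| ≤ η₁)
    (hAdet : ∀ x, η₂ ≤ (A x).det)
    (hALip : ∀ x y i j, |A x i j - A y i j| ≤ η₃ * ‖x - y‖)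
    -- μ₁,…,μ_d are symmetric Lévy densities supported in [−2δ,2δ]
    (μ : Fin d → ℝ → ℝ)
    (hμmeas : ∀ i, Measurable (μ i))
    (hμnonneg : ∀ i, ∀ w : ℝ, 0 ≤ μ i w)
    (hμsymm : ∀ i, ∀ w : ℝ, μ i (-w) = μ i w)
    (hμsupp : ∀ i, ∀ w : ℝ, 2 * δ < |w| → μ i w = 0)
    (hμmom : ∀ i, Integrable (fun w : ℝ => w ^ 2 * μ i w))
    (hμinf : ∀ i, ¬ Integrable (μ i))
    (v : ℝ → EuclideanSpace ℝ (Fin d) → ℝ)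
    (vap : ℝ → ℝ → EuclideanSpace ℝ (Fin d) → ℝ)
    -- each v^{(ξ)} is bounded on (0,τ]×ℝ^d, C¹ in time and C² in space
    (hbdd : ∀ ξ : ℝ, 0 < ξ → ξ ≤ 1 → ∀ τ : ℝ, 0 < τ →
      ∃ M : ℝ, ∀ t : ℝ, 0 < t → t ≤ τ → ∀ x, |vap ξ t x| ≤ M)
    (hC1 : ∀ ξ : ℝ, 0 < ξ → ξ ≤ 1 → ∀ x, ContDiffOn ℝ 1 (fun t => vap ξ t x) (Set.Ioi 0))
    (hC2 : ∀ ξ : ℝ, 0 < ξ → ξ ≤ 1 → ∀ t : ℝ, 0 < t → ContDiff ℝ 2 (fun x => vap ξ t x))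
    -- (i) v^{(ξ)} → v uniformly on [0,τ]×ℝ^d as ξ → 0⁺
    (hi : ∀ τ : ℝ, 0 < τ → ∀ e : ℝ, 0 < e → ∃ ξ₀ : ℝ, 0 < ξ₀ ∧ ξ₀ ≤ 1 ∧
      ∀ ξ : ℝ, 0 < ξ → ξ ≤ ξ₀ → ∀ t : ℝ, 0 ≤ t → t ≤ τ → ∀ x,
        |vap ξ t x - v t x| ≤ e)
    -- (ii) v^{(ξ)}(t,x) → 0 as |x| → ∞, uniformly in t ∈ [0,τ], ξ ∈ (0,1]
    (hii : ∀ τ : ℝ, 0 < τ → ∀ e : ℝ, 0 < e → ∃ R : ℝ,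
      ∀ ξ : ℝ, 0 < ξ → ξ ≤ 1 → ∀ t : ℝ, 0 ≤ t → t ≤ τ → ∀ x, R ≤ ‖x‖ →
        |vap ξ t x| ≤ e)
    -- (iii) ∂ₜ v^{(ξ)} − 𝓛 v^{(ξ)} → 0 uniformly on [τ₁,τ₂]×ℝ^d as ξ → 0⁺
    (hiii : ∀ τ : ℝ, 0 < τ → ∀ τ₁ τ₂ : ℝ, 0 < τ₁ → τ₁ < τ₂ → τ₂ ≤ τ →
      ∀ e : ℝ, 0 < e → ∃ ξ₀ : ℝ, 0 < ξ₀ ∧ ξ₀ ≤ 1 ∧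
        ∀ ξ : ℝ, 0 < ξ → ξ ≤ ξ₀ → ∀ t : ℝ, τ₁ ≤ t → t ≤ τ₂ → ∀ x,
          |deriv (fun s => vap ξ s x) t - Lop d A μ (fun z => vap ξ t z) x| ≤ e)
    -- (iv) v^{(ξ)}(t,x) → v(0,x) as ξ → 0⁺ and t → 0⁺, uniformly in x
    (hiv : ∀ e : ℝ, 0 < e → ∃ ξ₀ t₀ : ℝ, 0 < ξ₀ ∧ ξ₀ ≤ 1 ∧ 0 < t₀ ∧
      ∀ ξ : ℝ, 0 < ξ → ξ ≤ ξ₀ → ∀ t : ℝ, 0 ≤ t → t ≤ t₀ → ∀ x,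
        |vap ξ t x - v 0 x| ≤ e)
    -- (v) v(0,·) ≥ 0
    (hv0 : ∀ x, 0 ≤ v 0 x) :
    ∀ t : ℝ, 0 ≤ t → ∀ x, 0 ≤ v t x := by
  have hL : PMP.LProp (Lop d A μ) :=
    PMP.Lop_LProp d δ η₁ A hAbd μ hμmeas hμnonneg hμsupp hμmom
  intro t ht x
  rcases ht.eq_or_lt with rfl | htp
  · exact hv0 x
  apply le_of_forall_pos_le_add
  intro ε hε
  have hc : 0 < 2 + 2 * t := by positivity
  set κ := ε / (2 + 2 * t) with hκ
  have hκ0 : 0 < κ := by positivity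
  obtain ⟨ξ₁, h1p, h1l, h1⟩ := hi t htp κ hκ0
  obtain ⟨ξ₂, t₀, h2p, h2l, ht0, h2⟩ := hiv κ hκ0
  obtain ⟨R, hR⟩ := hii t htp κ hκ0
  have ha0 : 0 < min t₀ t / 2 := by positivity
  have hat : min t₀ t / 2 < t := by linarith [min_le_right t₀ t]
  have hat0 : min t₀ t / 2 ≤ t₀ := by linarith [min_le_left t₀ t]
  generalize min t₀ t / 2 = a at ha0 hat hat0
  obtain ⟨ξ₃, h3p, h3l, h3⟩ := hiii t htp a t ha0 hat le_rfl κ hκ0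
  have hξ0 : 0 < min ξ₁ (min ξ₂ ξ₃) := by positivity
  have hξ1 : min ξ₁ (min ξ₂ ξ₃) ≤ ξ₁ := min_le_left _ _
  have hξ2 : min ξ₁ (min ξ₂ ξ₃) ≤ ξ₂ := (min_le_right _ _).trans (min_le_left _ _)
  have hξ3 : min ξ₁ (min ξ₂ ξ₃) ≤ ξ₃ := (min_le_right _ _).trans (min_le_right _ _)
  generalize min ξ₁ (min ξ₂ ξ₃) = ξ at hξ0 hξ1 hξ2 hξ3
  have hξl : ξ ≤ 1 := hξ1.trans h1l
  obtain ⟨M, hM⟩ := hbdd ξ hξ0 hξl t htp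
  have hS : PMP.SSol (Lop d A μ) κ M a t (vap ξ) := by
    refine ⟨?_, ?_, ?_⟩
    · intro s hs
      exact hC2 ξ hξ0 hξl s (ha0.trans_le hs.1)
    · intro s hs y
      have hsp : 0 < s := ha0.trans_le hs.1
      refine ⟨deriv (fun r => vap ξ r y) s, ?_, ?_⟩
      · have hd1 : DifferentiableAt ℝ (fun r => vap ξ r y) s :=
          ((hC1 ξ hξ0 hξl y).differentiableOn (by norm_num)).differentiableAt (Ioi_mem_nhds hsp)
        exact hd1.hasDerivAt
      · have := (abs_le.1 (h3 ξ hξ0 hξ3 s hs.1 hs.2 y)).1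
        change Lop d A μ (fun z => vap ξ s z) y - κ ≤ _
        linarith
    · intro s hs y
      exact hM s (ha0.trans_le hs.1) hs.2 y
  have hfin := PMP.mainProp hL hκ0 hat.le hS (max R 1) κ (by positivity) hκ0.le
    (fun s hs y hy => hR ξ hξ0 hξl s (ha0.le.trans hs.1) hs.2 y ((le_max_left _ _).trans hy))
    (fun y => by
      have := (abs_le.1 (h2 ξ hξ0 hξ2 a ha0.le hat0 y)).1
      linarith [hv0 y]) x
  have h4 := (abs_le.1 (h1 ξ hξ0 hξ1 t ht le_rfl x)).2
  have h5 : κ * (2 + 2 * t) = ε := by rw [hκ]; field_simp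
  nlinarith [mul_pos hκ0 ha0]
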